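/- arXiv:1705.09420 — 2 statements merged into one kernel-verified Lean document; each statement's English description precedes it below -/
import Mathlib

section
/- Let M be a complex manifold, (K^•, d_K) a complex of sheaves of C^∞ differential forms on M, S a closed subset of M, and U_0 = M ∖ S. Then the relative cohomology H^r_{D_K}(𝒰, U_0), defined using a covering 𝒰 = {U_0, U_1} with U_1 an open neighborhood of S, is determined uniquely up to canonical isomorphism, independently of the choice of the neighborhood U_1: for two choices U_1 and U_1', there is a canonical isomorphism between the corresponding relative cohomology groups. -/
/-!
Statement 3.  Let `M` be a complex manifold, `(K^•, d_K)` a complex of sheaves of `C^∞`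
differential forms on `M`, `S` a closed subset, `U₀ = M ∖ S`.  The relative cohomology
`H^r_{D_K}(𝒰, U₀)` defined using a covering `𝒰 = {U₀, U₁}`, `U₁` an open neighborhood of
`S`, is determined uniquely up to canonical isomorphism, independently of the choice of `U₁`.

The complex of sheaves of `C^∞` forms is modelled abstractly by `FormComplex`; the relative
cochain group is `K^r(𝒰, U₀) = K^r(U₁) ⊕ K^{r-1}(U₀₁)` with
`D_K(σ₁, σ₀₁) = (d_K σ₁, σ₁ - d_K σ₀₁)`; for `U₁' ≤ U₁` the canonical comparison map is
induced by restriction of cochains.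
-/

open TopologicalSpace

universe u

/-- The cohomology of a pair of composable linear maps `f : A → B`, `g : B → C` with
`g ∘ f = 0` (in the situations where this is used):  `Ker g / Im f`. -/
abbrev cohomOf {A B C : Type u} [AddCommGroup A] [Module ℂ A] [AddCommGroup B] [Module ℂ B]
    [AddCommGroup C] [Module ℂ C] (f : A →ₗ[ℂ] B) (g : B →ₗ[ℂ] C) : Type u :=
  ↥(LinearMap.ker g) ⧸ (Submodule.comap (LinearMap.ker g).subtype (LinearMap.range f))

/-- The cohomology class of a cocycle. -/
def cohomMk {A B C : Type u} [AddCommGroup A] [Module ℂ A] [AddCommGroup B] [Module ℂ B]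
    [AddCommGroup C] [Module ℂ C] (f : A →ₗ[ℂ] B) (g : B →ₗ[ℂ] C) (b : B) (hb : g b = 0) :
    cohomOf f g :=
  Submodule.Quotient.mk ⟨b, LinearMap.mem_ker.mpr hb⟩

/-- A complex of sheaves of `C^∞` differential forms on (the underlying topological space of)
a complex manifold, encoded abstractly. -/
structure FormComplex (X : Type u) [TopologicalSpace X] : Type (u + 1) where
  /-- the `ℂ`-module of sections of degree `r` over an open set `U` -/
  K : ℤ → Opens X → ModuleCat.{u} ℂ
  /-- restriction of sections -/
  res : ∀ (r : ℤ) ⦃U V : Opens X⦄, U ≤ V → ((K r V) →ₗ[ℂ] (K r U))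
  res_refl : ∀ (r : ℤ) (U : Opens X) (x : K r U), res r (le_refl U) x = x
  res_res : ∀ (r : ℤ) ⦃U V W : Opens X⦄ (hUV : U ≤ V) (hVW : V ≤ W) (x : K r W),
      res r hUV (res r hVW x) = res r (hUV.trans hVW) x
  /-- the differential `d_K` -/
  d : ∀ (r : ℤ) (U : Opens X), (K r U) →ₗ[ℂ] (K (r + 1) U)
  d_d : ∀ (r : ℤ) (U : Opens X) (x : K r U), d (r + 1) U (d r U x) = 0
  d_res : ∀ (r : ℤ) ⦃U V : Opens X⦄ (h : U ≤ V) (x : K r V),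
      d r U (res r h x) = res (r + 1) h (d r V x)
  /-- sheaf condition: sections agreeing on the overlap glue -/
  glue : ∀ (r : ℤ) ⦃U V : Opens X⦄ (a : K r U) (b : K r V),
      res r inf_le_left a = res r inf_le_right b →
      ∃! c : K r (U ⊔ V), res r le_sup_left c = a ∧ res r le_sup_right c = b
  /-- softness coming from `C^∞` partitions of unity subordinate to a two-set open cover:
  "multiplication by `ρ₁` (resp. `ρ₀`) followed by extension by zero" operators. -/
  pou : ∀ ⦃U V : Opens X⦄, U ⊔ V = ⊤ →
      ∃ (z₀ : ∀ r : ℤ, ((K r (U ⊓ V)) →ₗ[ℂ] (K r U)))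
        (z₁ : ∀ r : ℤ, ((K r (U ⊓ V)) →ₗ[ℂ] (K r V))),
        ∀ (r : ℤ) (x : K r (U ⊓ V)),
          res r inf_le_left (z₀ r x) + res r inf_le_right (z₁ r x) = x

namespace FormComplex

variable {X : Type u} [TopologicalSpace X] (F : FormComplex X)

/-- identification of the modules of sections in equal degrees -/
def cast (U : Opens X) : ∀ {r s : ℤ}, r = s → ((F.K r U) →ₗ[ℂ] (F.K s U))
  | _, _, rfl => LinearMap.id

/-- The Čech cochains of the complex on the covering `𝒰 = {U₀, U₁}`:
`K^r(𝒰) = K^r(U₀) ⊕ K^r(U₁) ⊕ K^{r-1}(U₀₁)`, `U₀₁ = U₀ ⊓ U₁`. -/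
abbrev Cochain (U₀ U₁ : Opens X) (r : ℤ) : Type u :=
  ↥(F.K r U₀) × ↥(F.K r U₁) × ↥(F.K (r - 1) (U₀ ⊓ U₁))

/-- The Čech differential `D_K σ = (d_K σ₀, d_K σ₁, σ₁ - σ₀ - d_K σ₀₁)`. -/
def Dmap (U₀ U₁ : Opens X) (r : ℤ) :
    Cochain F U₀ U₁ r →ₗ[ℂ] Cochain F U₀ U₁ (r + 1) :=
  LinearMap.prod
    ((F.d r U₀).comp (LinearMap.fst ℂ _ _))
    (LinearMap.prod
      ((F.d r U₁).comp ((LinearMap.fst ℂ _ _).comp (LinearMap.snd ℂ _ _)))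
      (((F.cast (U₀ ⊓ U₁) (show r = r + 1 - 1 by ring)).comp
          (((F.res r inf_le_right).comp
              ((LinearMap.fst ℂ _ _).comp (LinearMap.snd ℂ _ _))) -
            ((F.res r inf_le_left).comp (LinearMap.fst ℂ _ _)))) -
        ((F.cast (U₀ ⊓ U₁) (show (r - 1) + 1 = r + 1 - 1 by ring)).comp
          ((F.d (r - 1) (U₀ ⊓ U₁)).comp
            ((LinearMap.snd ℂ _ _).comp (LinearMap.snd ℂ _ _))))))


/-- relative Čech cochains `K^r(𝒰, U₀) = {σ ∈ K^r(𝒰) ∣ σ₀ = 0} = K^r(U₁) ⊕ K^{r-1}(U₀₁)` -/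
abbrev RelCochain (U₀ U₁ : Opens X) (r : ℤ) : Type u :=
  ↥(F.K r U₁) × ↥(F.K (r - 1) (U₀ ⊓ U₁))

/-- the relative Čech differential `D_K σ = (d_K σ₁, σ₁ - d_K σ₀₁)` -/
def Drel (U₀ U₁ : Opens X) (r : ℤ) :
    RelCochain F U₀ U₁ r →ₗ[ℂ] RelCochain F U₀ U₁ (r + 1) :=
  LinearMap.prod ((F.d r U₁).comp (LinearMap.fst ℂ _ _))
    (((F.cast (U₀ ⊓ U₁) (show r = r + 1 - 1 by ring)).comp
        ((F.res r inf_le_right).comp (LinearMap.fst ℂ _ _))) -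
      ((F.cast (U₀ ⊓ U₁) (show r - 1 + 1 = r + 1 - 1 by ring)).comp
        ((F.d (r - 1) (U₀ ⊓ U₁)).comp (LinearMap.snd ℂ _ _))))

/-- identification of relative cochains in equal degrees -/
def relCast (U₀ U₁ : Opens X) {r s : ℤ} (h : r = s) :
    RelCochain F U₀ U₁ r →ₗ[ℂ] RelCochain F U₀ U₁ s :=
  LinearMap.prod ((F.cast U₁ h).comp (LinearMap.fst ℂ _ _))
    ((F.cast _ (by rw [h])).comp (LinearMap.snd ℂ _ _))

/-- the relative cohomology `H^r_{D_K}(𝒰, U₀)` (defined for any pair of open sets `U₀ U₁`;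
for `U₀ = M ∖ S` and `U₁` a neighborhood of `S` this is `H^r_{d_K}(M, M ∖ S)`). -/
abbrev Hrel (U₀ U₁ : Opens X) (r : ℤ) : Type u :=
  cohomOf ((relCast F U₀ U₁ (show r - 1 + 1 = r by ring)).comp (Drel F U₀ U₁ (r - 1)))
    (Drel F U₀ U₁ r)

/-- the restriction map of relative cochains for a smaller neighborhood `U₁' ≤ U₁` -/
def relRes (U₀ : Opens X) {U₁ U₁' : Opens X} (h : U₁' ≤ U₁) (r : ℤ) :
    RelCochain F U₀ U₁ r →ₗ[ℂ] RelCochain F U₀ U₁' r :=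
  LinearMap.prod ((F.res r h).comp (LinearMap.fst ℂ _ _))
    ((F.res (r - 1) (inf_le_inf_left U₀ h)).comp (LinearMap.snd ℂ _ _))
end FormComplex

open FormComplex

/-- A linear map `φ` which respects cocycles and coboundaries, and is injective and surjective on
cohomology classes, induces an isomorphism of cohomology. -/
theorem exists_cohomOf_equiv {A B C A' B' C' : Type u}
    [AddCommGroup A] [Module ℂ A] [AddCommGroup B] [Module ℂ B] [AddCommGroup C] [Module ℂ C]
    [AddCommGroup A'] [Module ℂ A'] [AddCommGroup B'] [Module ℂ B'] [AddCommGroup C'] [Module ℂ C']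
    (f : A →ₗ[ℂ] B) (g : B →ₗ[ℂ] C) (f' : A' →ₗ[ℂ] B') (g' : B' →ₗ[ℂ] C') (φ : B →ₗ[ℂ] B')
    (hker : ∀ b, g b = 0 → g' (φ b) = 0) (hrange : ∀ a, ∃ a', f' a' = φ (f a))
    (hinj : ∀ b, g b = 0 → ∀ a', f' a' = φ b → ∃ a, f a = b)
    (hsurj : ∀ b', g' b' = 0 → ∃ b, g b = 0 ∧ ∃ a', f' a' = b' - φ b) :
    ∃ e : cohomOf f g ≃ₗ[ℂ] cohomOf f' g', ∀ (b : B) (hb : g b = 0),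
      ∃ h', e (cohomMk f g b hb) = cohomMk f' g' (φ b) h' := by
  let ψ : LinearMap.ker g →ₗ[ℂ] LinearMap.ker g' := φ.restrict hker
  have hψ : Submodule.comap (LinearMap.ker g).subtype (LinearMap.range f) ≤
      Submodule.comap ψ (Submodule.comap (LinearMap.ker g').subtype (LinearMap.range f')) := by
    rintro ⟨b, hb⟩ ⟨a, rfl⟩
    exact hrange a
  refine ⟨LinearEquiv.ofBijective (Submodule.mapQ _ _ ψ hψ) ⟨?_, ?_⟩, fun b hb ↦ ⟨hker b hb, rfl⟩⟩
  · rw [injective_iff_map_eq_zero]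
    intro x hx
    induction x using Submodule.Quotient.induction_on with
    | H x =>
      obtain ⟨b, hb⟩ := x
      rw [Submodule.mapQ_apply, Submodule.Quotient.mk_eq_zero] at hx
      obtain ⟨a', ha'⟩ := hx
      rw [Submodule.Quotient.mk_eq_zero]
      exact hinj b hb a' ha'
  · intro y
    induction y using Submodule.Quotient.induction_on with
    | H y =>
      obtain ⟨b', hb'⟩ := y
      obtain ⟨b, hb, a', ha'⟩ := hsurj b' hb'
      refine ⟨Submodule.Quotient.mk ⟨b, hb⟩, ?_⟩
      rw [Submodule.mapQ_apply]
      have hcob : (⟨b', hb'⟩ : LinearMap.ker g') - ψ ⟨b, hb⟩ ∈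
          Submodule.comap (LinearMap.ker g').subtype (LinearMap.range f') := ⟨a', ha'⟩
      exact ((Submodule.Quotient.eq _).mpr hcob).symm

namespace FormComplex

variable {X : Type u} [TopologicalSpace X] (F : FormComplex X)

theorem cast_rfl (U : Opens X) {r : ℤ} (h : r = r) (x : F.K r U) : F.cast U h x = x := rfl

theorem cast_cast (U : Opens X) {r s t : ℤ} (h : r = s) (h' : s = t) (x : F.K r U) :
    F.cast U h' (F.cast U h x) = F.cast U (h.trans h') x := by
  subst h h'; rfl

theorem cast_eq_zero_iff (U : Opens X) {r s : ℤ} (h : r = s) (x : F.K r U) :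
    F.cast U h x = 0 ↔ x = 0 := by
  subst h; rfl

/-- The differential, with values in any degree equal to `r + 1`. -/
def dTo (U : Opens X) {r s : ℤ} (h : r + 1 = s) : (F.K r U) →ₗ[ℂ] (F.K s U) :=
  (F.cast U h).comp (F.d r U)

theorem dTo_dTo (U : Opens X) {r s t : ℤ} (h : r + 1 = s) (h' : s + 1 = t) (x : F.K r U) :
    F.dTo U h' (F.dTo U h x) = 0 := by
  subst h h'; exact F.d_d r U x

theorem dTo_res {U V : Opens X} (hUV : U ≤ V) {r s : ℤ} (h : r + 1 = s) (x : F.K r V) :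
    F.dTo U h (F.res r hUV x) = F.res s hUV (F.dTo V h x) := by
  subst h; exact F.d_res r hUV x

theorem exists_glue {U V W I : Opens X} (hU : U ≤ W) (hV : V ≤ W) (hIU : I ≤ U) (hIV : I ≤ V)
    (hW : U ⊔ V = W) (hI : U ⊓ V = I) (r : ℤ) (a : F.K r U) (b : F.K r V)
    (hab : F.res r hIU a = F.res r hIV b) :
    ∃ c : F.K r W, F.res r hU c = a ∧ F.res r hV c = b := by
  subst hW hI
  exact (F.glue r a b hab).exists

theorem eq_of_res_eq {U V W : Opens X} (hU : U ≤ W) (hV : V ≤ W) (hW : U ⊔ V = W) (r : ℤ)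
    (c c' : F.K r W) (h : F.res r hU c = F.res r hU c') (h' : F.res r hV c = F.res r hV c') :
    c = c' := by
  subst hW
  refine (F.glue r (F.res r hU c') (F.res r hV c') ?_).unique ⟨h, h'⟩ ⟨rfl, rfl⟩
  rw [F.res_res, F.res_res]

theorem Drel_eq_zero_iff (U₀ U₁ : Opens X) (r : ℤ) (σ : RelCochain F U₀ U₁ r) :
    Drel F U₀ U₁ r σ = 0 ↔ F.dTo U₁ rfl σ.1 = 0 ∧
      F.res r inf_le_right σ.1 = F.dTo (U₀ ⊓ U₁) (sub_add_cancel r 1) σ.2 := by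
  have key : F.cast (U₀ ⊓ U₁) (show r = r + 1 - 1 by ring)
      (F.res r inf_le_right σ.1 - F.dTo (U₀ ⊓ U₁) (sub_add_cancel r 1) σ.2) =
      (Drel F U₀ U₁ r σ).2 := by
    simp only [dTo, map_sub, LinearMap.comp_apply, cast_cast]
    rfl
  rw [Prod.ext_iff, Prod.snd_zero, ← key, cast_eq_zero_iff, sub_eq_zero]
  rfl

theorem relCast_Drel (U₀ U₁ : Opens X) (r : ℤ) (h : r - 1 + 1 = r)
    (τ : RelCochain F U₀ U₁ (r - 1)) :
    relCast F U₀ U₁ h (Drel F U₀ U₁ (r - 1) τ) =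
      (F.dTo U₁ h τ.1,
        F.res (r - 1) inf_le_right τ.1 - F.dTo (U₀ ⊓ U₁) (sub_add_cancel (r - 1) 1) τ.2) := by
  refine Prod.ext rfl ?_
  simp only [relCast, Drel, dTo, LinearMap.prod_apply, Function.prod_apply, LinearMap.comp_apply,
    LinearMap.snd_apply, LinearMap.fst_apply, LinearMap.sub_apply, map_sub, cast_cast, cast_rfl]

/-- When `U₀` and `U₁'` cover `X`, sections over `U₀ ⊓ U₁'` are sums of restrictions from
`U₁'` and from `U₀ ⊓ U₁`, for every `U₁`. -/
theorem exists_res_add_res {U₀ U₁ U₁' : Opens X} (h : U₁' ≤ U₁) (hcov : U₀ ⊔ U₁' = ⊤) (r : ℤ)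
    (x : F.K r (U₀ ⊓ U₁')) :
    ∃ (y : F.K r U₁') (z : F.K r (U₀ ⊓ U₁)),
      F.res r inf_le_right y + F.res r (inf_le_inf_left U₀ h) z = x := by
  obtain ⟨z₀, z₁, hz⟩ := F.pou hcov
  refine ⟨z₁ r x, F.res r inf_le_left (z₀ r x), ?_⟩
  rw [F.res_res, add_comm]
  exact hz r x

/-- Restriction of relative cochains to a smaller neighborhood is an isomorphism on
cohomology. -/
theorem exists_Hrel_equiv {U₀ U₁ U₁' : Opens X} (h : U₁' ≤ U₁) (hcov : U₀ ⊔ U₁' = ⊤) (r : ℤ) :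
    ∃ e : Hrel F U₀ U₁ r ≃ₗ[ℂ] Hrel F U₀ U₁' r,
      ∀ (σ : RelCochain F U₀ U₁ r) (hσ : Drel F U₀ U₁ r σ = 0),
        ∃ h', e (cohomMk _ (Drel F U₀ U₁ r) σ hσ)
          = cohomMk _ (Drel F U₀ U₁' r) (relRes F U₀ h r σ) h' := by
  have hI : U₀ ⊓ U₁' ≤ U₀ ⊓ U₁ := inf_le_inf_left U₀ h
  have hsup : U₁' ⊔ (U₀ ⊓ U₁) = U₁ := by
    rw [sup_inf_left, sup_comm U₁' U₀, hcov, top_inf_eq, sup_eq_right.mpr h]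
  have hinf : U₁' ⊓ (U₀ ⊓ U₁) = U₀ ⊓ U₁' := by
    rw [inf_left_comm, inf_eq_left.mpr h]
  apply exists_cohomOf_equiv
  · rintro ⟨s, t⟩ hσ
    rw [Drel_eq_zero_iff] at hσ ⊢
    obtain ⟨hs, hst⟩ := hσ
    dsimp only at hs hst
    refine ⟨?_, ?_⟩
    · change F.dTo U₁' rfl (F.res r h s) = 0
      rw [dTo_res, hs, map_zero]
    · change F.res r inf_le_right (F.res r h s) = F.dTo _ _ (F.res (r - 1) hI t)
      rw [dTo_res, ← hst, F.res_res, F.res_res]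
  · rintro ⟨a, b⟩
    refine ⟨relRes F U₀ h (r - 1) (a, b), ?_⟩
    rw [LinearMap.comp_apply, LinearMap.comp_apply, relCast_Drel, relCast_Drel]
    change (F.dTo U₁' _ (F.res (r - 1) h a), F.res (r - 1) inf_le_right (F.res (r - 1) h a) -
      F.dTo _ _ (F.res (r - 1 - 1) hI b)) =
      (F.res r h (F.dTo U₁ _ a),
        F.res (r - 1) hI (F.res (r - 1) inf_le_right a - F.dTo _ _ b))
    rw [dTo_res, dTo_res, map_sub, F.res_res, F.res_res]
  · rintro ⟨s, t⟩ hσ ⟨a, b⟩ hab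
    rw [Drel_eq_zero_iff] at hσ
    obtain ⟨hs, hst⟩ := hσ
    dsimp only at hs hst
    rw [LinearMap.comp_apply, relCast_Drel] at hab
    obtain ⟨ha, hb⟩ := Prod.ext_iff.mp hab
    change F.dTo U₁' _ a = F.res r h s at ha
    change F.res (r - 1) inf_le_right a - F.dTo _ _ b = F.res (r - 1) hI t at hb
    obtain ⟨b₁, b₀, rfl⟩ := F.exists_res_add_res h hcov _ b
    obtain ⟨c, hc₁, hc₀⟩ := F.exists_glue h inf_le_right inf_le_right hI hsup hinf (r - 1)
      (a - F.dTo U₁' (sub_add_cancel (r - 1) 1) b₁)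
      (t + F.dTo (U₀ ⊓ U₁) (sub_add_cancel (r - 1) 1) b₀) (by
        rw [map_add, dTo_res, dTo_res] at hb
        rw [map_add, map_sub, ← hb]
        abel)
    refine ⟨(c, b₀), ?_⟩
    rw [LinearMap.comp_apply, relCast_Drel]
    refine Prod.ext ?_ ?_
    · refine F.eq_of_res_eq h inf_le_right hsup r _ _ ?_ ?_
      · rw [← dTo_res, hc₁, map_sub, dTo_dTo, sub_zero, ha]
      · rw [← dTo_res, hc₀, map_add, dTo_dTo, add_zero, hst]
    · change F.res (r - 1) inf_le_right c - _ = t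
      rw [hc₀, add_sub_cancel_right]
  · rintro ⟨a, b⟩ hσ
    rw [Drel_eq_zero_iff] at hσ
    obtain ⟨ha, hab⟩ := hσ
    dsimp only at ha hab
    obtain ⟨b₁, b₀, rfl⟩ := F.exists_res_add_res h hcov _ b
    obtain ⟨c, hc₁, hc₀⟩ := F.exists_glue h inf_le_right inf_le_right hI hsup hinf r
      (a - F.dTo U₁' (sub_add_cancel r 1) b₁) (F.dTo (U₀ ⊓ U₁) (sub_add_cancel r 1) b₀) (by
        rw [map_sub, hab, map_add, dTo_res, dTo_res, add_sub_cancel_left])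
    refine ⟨(c, b₀), ?_, (b₁, 0), ?_⟩
    · rw [Drel_eq_zero_iff]
      refine ⟨F.eq_of_res_eq h inf_le_right hsup _ _ _ ?_ ?_, hc₀⟩
      · rw [← dTo_res, hc₁, map_sub, ha, dTo_dTo, sub_zero, map_zero]
      · rw [← dTo_res, hc₀, dTo_dTo, map_zero]
    · rw [LinearMap.comp_apply, relCast_Drel]
      refine Prod.ext ?_ ?_
      · change F.dTo U₁' _ b₁ = a - F.res r h c
        rw [hc₁, sub_sub_cancel]
      · change F.res (r - 1) inf_le_right b₁ - F.dTo _ _ 0 =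
          F.res (r - 1) inf_le_right b₁ + F.res (r - 1) hI b₀ - F.res (r - 1) hI b₀
        rw [map_zero, sub_zero, add_sub_cancel_right]

end FormComplex

/-- Corollary 3.7 of the paper.  Let `(K^•, d_K)` be a complex of sheaves of
`C^∞` differential forms on a complex manifold `M` and `S ⊆ M` closed, `U₀ = M ∖ S`.  The
relative cohomology `H^r_{D_K}(𝒰, U₀)`, for `𝒰 = {U₀, U₁}` with `U₁` an open neighborhood
of `S`, does not depend on the choice of `U₁` up to canonical isomorphism: for `U₁' ⊆ U₁`
the restriction of cochains induces an isomorphism, and for two arbitrary neighborhoods the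
corresponding relative cohomologies are canonically isomorphic. -/
theorem statement3 {X : Type u} [TopologicalSpace X] (F : FormComplex X)
    (S : Set X) (hS : IsClosed S) :
    letI U₀ : Opens X := ⟨Sᶜ, hS.isOpen_compl⟩
    -- for `U₁' ≤ U₁` the restriction-induced map is an isomorphism …
    (∀ (U₁ U₁' : Opens X) (_ : S ⊆ U₁) (_ : S ⊆ U₁') (h : U₁' ≤ U₁) (r : ℤ),
      ∃ e : Hrel F U₀ U₁ r ≃ₗ[ℂ] Hrel F U₀ U₁' r,
        ∀ (σ : RelCochain F U₀ U₁ r) (hσ : Drel F U₀ U₁ r σ = 0),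
          ∃ h', e (cohomMk _ (Drel F U₀ U₁ r) σ hσ)
            = cohomMk _ (Drel F U₀ U₁' r) (relRes F U₀ h r σ) h') ∧
    -- … whence for any two neighborhoods of `S` the relative cohomologies are isomorphic
    (∀ (U₁ U₁' : Opens X) (_ : S ⊆ U₁) (_ : S ⊆ U₁') (r : ℤ),
      Nonempty (Hrel F U₀ U₁ r ≃ₗ[ℂ] Hrel F U₀ U₁' r)) := by
  have hcov (U : Opens X) (hU : S ⊆ U) : (⟨Sᶜ, hS.isOpen_compl⟩ : Opens X) ⊔ U = ⊤ := by
    refine eq_top_iff.mpr fun x _ ↦ ?_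
    by_cases hx : x ∈ S
    · exact Or.inr (hU hx)
    · exact Or.inl hx
  refine ⟨fun U₁ U₁' _ hU₁' h r ↦ F.exists_Hrel_equiv h (hcov U₁' hU₁') r,
    fun U₁ U₁' hU₁ hU₁' r ↦ ?_⟩
  have hcov' := hcov (U₁ ⊓ U₁') (Set.subset_inter hU₁ hU₁')
  obtain ⟨e, -⟩ := F.exists_Hrel_equiv (inf_le_left : U₁ ⊓ U₁' ≤ U₁) hcov' r
  obtain ⟨e', -⟩ := F.exists_Hrel_equiv (inf_le_right : U₁ ⊓ U₁' ≤ U₁') hcov' r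
  exact ⟨e.trans e'.symm⟩
end

section
/- Let M be a complex manifold and 𝒰 = {U_0, U_1} an open covering of M. The Čech-Aeppli coboundary group B^{p,q}_A(𝒰) coincides with the set B' of cochains ξ = (ξ_0, ξ_1, ξ_{01}^{(1)}, ξ_{01}^{(2)}) ∈ E^{p,q}_A(𝒰) for which there exist η_i^{(1)} ∈ E^{p,q-1}(U_i), η_i^{(2)} ∈ E^{p-1,q}(U_i) (i = 0, 1), η_{01}^{(11)} ∈ E^{p,q-2}(U_{01}), η_{01}^{(12)} = η_{01}^{(21)} ∈ E^{p-1,q-1}(U_{01}), η_{01}^{(22)} ∈ E^{p-2,q}(U_{01}) with ξ_i = ∂̄η_i^{(1)} + ∂η_i^{(2)} and ξ_{01}^{(k)} = η_1^{(k)} − η_0^{(k)} − ∂̄η_{01}^{(k1)} − ∂η_{01}^{(k2)} for k = 1, 2; that is, the relaxed coboundary condition defines the same subgroup. -/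
/-!
Statement 6 (Lemma 3.10 of the paper).  Let `M` be a complex manifold and `𝒰 = {U₀, U₁}`
an open covering of `M`.  The Čech–Aeppli coboundary group `B^{p,q}_A(𝒰)` coincides with
the set `B'` defined by the relaxed coboundary condition: `ξ = (ξ₀, ξ₁, ξ₀₁⁽¹⁾, ξ₀₁⁽²⁾)`
such that there exist `η_i⁽¹⁾ ∈ E^{p,q-1}(U_i)`, `η_i⁽²⁾ ∈ E^{p-1,q}(U_i)` (`i = 0, 1`),
`η₀₁⁽¹¹⁾ ∈ E^{p,q-2}(U₀₁)`, `η₀₁⁽¹²⁾ = η₀₁⁽²¹⁾ ∈ E^{p-1,q-1}(U₀₁)`,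
`η₀₁⁽²²⁾ ∈ E^{p-2,q}(U₀₁)` with `ξ_i = ∂̄η_i⁽¹⁾ + ∂η_i⁽²⁾` and
`ξ₀₁⁽ᵏ⁾ = η₁⁽ᵏ⁾ - η₀⁽ᵏ⁾ - ∂̄η₀₁⁽ᵏ¹⁾ - ∂η₀₁⁽ᵏ²⁾` for `k = 1, 2`.

The sheaves of `(p,q)`-forms are modelled abstractly by `DoubleFormSheaf` (a presheaf of
`ℂ`-modules with `∂`, `∂̄`, sheaf gluing and the partition-of-unity property `pou`).
`B^{p,q}_A(𝒰)` is the image of the Čech differential into the Aeppli cochains, i.e. the set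
of `ξ` with `ξ_i = ∂̄η_i⁽¹⁾ + ∂η_i⁽²⁾`, `ξ₀₁⁽¹⁾ = η₁⁽¹⁾ - η₀⁽¹⁾ - ∂η₀₁`,
`ξ₀₁⁽²⁾ = η₁⁽²⁾ - η₀⁽²⁾ - ∂̄η₀₁` (a single `η₀₁ ∈ E^{p-1,q-1}(U₀₁)`).
-/

open TopologicalSpace

universe u

section LinearHelpers

variable {A B C S : Type u} [AddCommGroup A] [Module ℂ A] [AddCommGroup B] [Module ℂ B]
  [AddCommGroup C] [Module ℂ C] [AddCommGroup S] [Module ℂ S]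

/-- a linear map into a triple product -/
def lmTri (f : S →ₗ[ℂ] A) (g : S →ₗ[ℂ] B) (h : S →ₗ[ℂ] C) : S →ₗ[ℂ] A × B × C :=
  LinearMap.prod f (LinearMap.prod g h)

/-- first projection of a triple product -/
def pA : A × B × C →ₗ[ℂ] A := LinearMap.fst ℂ A (B × C)

/-- second projection of a triple product -/
def pB : A × B × C →ₗ[ℂ] B := (LinearMap.fst ℂ B C).comp (LinearMap.snd ℂ A (B × C))

/-- third projection of a triple product -/
def pC : A × B × C →ₗ[ℂ] C := (LinearMap.snd ℂ B C).comp (LinearMap.snd ℂ A (B × C))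

/-- first projection of a pair -/
def qA : A × B →ₗ[ℂ] A := LinearMap.fst ℂ A B

/-- second projection of a pair -/
def qB : A × B →ₗ[ℂ] B := LinearMap.snd ℂ A B

end LinearHelpers

/-- The sheaves `E^{p,q}` of `C^∞` differential forms of type `(p,q)` on (the underlying
topological space of) a complex manifold, encoded abstractly: a presheaf of `ℂ`-modules
`E p q U` with the differentials `∂` (`del`) and `∂̄` (`dbar`), satisfying `∂² = ∂̄² = 0`,
`∂∂̄ + ∂̄∂ = 0`, compatibility with restrictions, the sheaf gluing condition for pairs of
open sets, and the softness property coming from `C^∞` partitions of unity (`pou`). -/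
structure DoubleFormSheaf (X : Type u) [TopologicalSpace X] : Type (u + 1) where
  /-- the `ℂ`-module of `(p,q)`-forms on an open set `U` -/
  E : ℤ → ℤ → Opens X → ModuleCat.{u} ℂ
  /-- restriction of forms -/
  res : ∀ (p q : ℤ) ⦃U V : Opens X⦄, U ≤ V → ((E p q V) →ₗ[ℂ] (E p q U))
  res_refl : ∀ (p q : ℤ) (U : Opens X) (x : E p q U), res p q (le_refl U) x = x
  res_res : ∀ (p q : ℤ) ⦃U V W : Opens X⦄ (hUV : U ≤ V) (hVW : V ≤ W) (x : E p q W),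
      res p q hUV (res p q hVW x) = res p q (hUV.trans hVW) x
  /-- the differential `∂` -/
  del : ∀ (p q : ℤ) (U : Opens X), (E p q U) →ₗ[ℂ] (E (p + 1) q U)
  /-- the differential `∂̄` -/
  dbar : ∀ (p q : ℤ) (U : Opens X), (E p q U) →ₗ[ℂ] (E p (q + 1) U)
  del_del : ∀ (p q : ℤ) (U : Opens X) (x : E p q U), del (p + 1) q U (del p q U x) = 0
  dbar_dbar : ∀ (p q : ℤ) (U : Opens X) (x : E p q U), dbar p (q + 1) U (dbar p q U x) = 0
  del_dbar : ∀ (p q : ℤ) (U : Opens X) (x : E p q U),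
      del p (q + 1) U (dbar p q U x) + dbar (p + 1) q U (del p q U x) = 0
  res_del : ∀ (p q : ℤ) ⦃U V : Opens X⦄ (h : U ≤ V) (x : E p q V),
      del p q U (res p q h x) = res (p + 1) q h (del p q V x)
  res_dbar : ∀ (p q : ℤ) ⦃U V : Opens X⦄ (h : U ≤ V) (x : E p q V),
      dbar p q U (res p q h x) = res p (q + 1) h (dbar p q V x)
  /-- sheaf condition: forms agreeing on the overlap glue -/
  glue : ∀ (p q : ℤ) ⦃U V : Opens X⦄ (a : E p q U) (b : E p q V),
      res p q inf_le_left a = res p q inf_le_right b →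
      ∃! c : E p q (U ⊔ V), res p q le_sup_left c = a ∧ res p q le_sup_right c = b
  /-- softness coming from `C^∞` partitions of unity subordinate to a two-set open cover:
  "multiplication by `ρ₁` (resp. `ρ₀`) followed by extension by zero" operators. -/
  pou : ∀ ⦃U V : Opens X⦄, U ⊔ V = ⊤ →
      ∃ (z₀ : ∀ p q : ℤ, ((E p q (U ⊓ V)) →ₗ[ℂ] (E p q U)))
        (z₁ : ∀ p q : ℤ, ((E p q (U ⊓ V)) →ₗ[ℂ] (E p q V))),
        ∀ (p q : ℤ) (x : E p q (U ⊓ V)),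
          res p q inf_le_left (z₀ p q x) + res p q inf_le_right (z₁ p q x) = x

namespace DoubleFormSheaf

variable {X : Type u} [TopologicalSpace X] (F : DoubleFormSheaf X)

/-- identification of the modules of forms in equal bidegrees -/
def cast (U : Opens X) :
    ∀ {p q p' q' : ℤ}, p = p' → q = q' → ((F.E p q U) →ₗ[ℂ] (F.E p' q' U))
  | _, _, _, _, rfl, rfl => LinearMap.id

section Cech

variable (U₀ U₁ : Opens X)

/-- Čech–Bott–Chern cochains `E^{p,q}_{BC}(𝒰) = E^{p,q}(U₀) ⊕ E^{p,q}(U₁) ⊕ E^{p-1,q-1}(U₀₁)` -/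
abbrev TBC (p q : ℤ) : Type u :=
  ↥(F.E p q U₀) × ↥(F.E p q U₁) × ↥(F.E (p - 1) (q - 1) (U₀ ⊓ U₁))

/-- Čech–Aeppli cochains
`E^{p,q}_{A}(𝒰) = E^{p,q}(U₀) ⊕ E^{p,q}(U₁) ⊕ E^{(p-1,q-1)+1}(U₀₁)`,
`E^{(p-1,q-1)+1} = E^{p,q-1} ⊕ E^{p-1,q}` -/
abbrev TA (p q : ℤ) : Type u :=
  ↥(F.E p q U₀) × ↥(F.E p q U₁) ×
    (↥(F.E p (q - 1) (U₀ ⊓ U₁)) × ↥(F.E (p - 1) q (U₀ ⊓ U₁)))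

/-- Čech cochains of the third type
`E^{(p,q)+1}(𝒰) = E^{(p,q)+1}(U₀) ⊕ E^{(p,q)+1}(U₁) ⊕ E^{p,q}(U₀₁)`,
`E^{(p,q)+1} = E^{p+1,q} ⊕ E^{p,q+1}` -/
abbrev TT (p q : ℤ) : Type u :=
  (↥(F.E (p + 1) q U₀) × ↥(F.E p (q + 1) U₀)) ×
    (↥(F.E (p + 1) q U₁) × ↥(F.E p (q + 1) U₁)) × ↥(F.E p q (U₀ ⊓ U₁))

/-- Čech–Dolbeault cochains `E^{p,q}(𝒰) = E^{p,q}(U₀) ⊕ E^{p,q}(U₁) ⊕ E^{p,q-1}(U₀₁)` -/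
abbrev TD (p q : ℤ) : Type u :=
  ↥(F.E p q U₀) × ↥(F.E p q U₁) × ↥(F.E p (q - 1) (U₀ ⊓ U₁))

/-- relative Čech–Bott–Chern cochains `E^{p,q}_{BC}(𝒰, U₀) = E^{p,q}(U₁) ⊕ E^{p-1,q-1}(U₀₁)` -/
abbrev RBC (p q : ℤ) : Type u :=
  ↥(F.E p q U₁) × ↥(F.E (p - 1) (q - 1) (U₀ ⊓ U₁))

/-- relative Čech–Aeppli cochains `E^{p,q}_{A}(𝒰, U₀) = E^{p,q}(U₁) ⊕ E^{(p-1,q-1)+1}(U₀₁)` -/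
abbrev RA (p q : ℤ) : Type u :=
  ↥(F.E p q U₁) × (↥(F.E p (q - 1) (U₀ ⊓ U₁)) × ↥(F.E (p - 1) q (U₀ ⊓ U₁)))

/-- relative Čech cochains of the third type `E^{(p,q)+1}(𝒰, U₀) = E^{(p,q)+1}(U₁) ⊕ E^{p,q}(U₀₁)` -/
abbrev RT (p q : ℤ) : Type u :=
  (↥(F.E (p + 1) q U₁) × ↥(F.E p (q + 1) U₁)) × ↥(F.E p q (U₀ ⊓ U₁))

/-- relative Čech–Dolbeault cochains `E^{p,q}(𝒰, U₀) = E^{p,q}(U₁) ⊕ E^{p,q-1}(U₀₁)` -/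
abbrev RD (p q : ℤ) : Type u :=
  ↥(F.E p q U₁) × ↥(F.E p (q - 1) (U₀ ⊓ U₁))

/-- the Čech differential `E^{p,q}_{BC}(𝒰) → E^{(p,q)+1}(𝒰)`,
`σ ↦ ((∂σ₀, ∂̄σ₀), (∂σ₁, ∂̄σ₁), σ₁ - σ₀ - ∂̄∂σ₀₁)` (i.e. `σ ↦ (dσ₀, dσ₁, σ₁ - σ₀ - ∂̄∂σ₀₁)`) -/
def DtoTT (p q : ℤ) : TBC F U₀ U₁ p q →ₗ[ℂ] TT F U₀ U₁ p q :=
  lmTri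
    (LinearMap.prod ((F.del p q U₀).comp pA) ((F.dbar p q U₀).comp pA))
    (LinearMap.prod ((F.del p q U₁).comp pB) ((F.dbar p q U₁).comp pB))
    (((F.res p q inf_le_right).comp pB - (F.res p q inf_le_left).comp pA) -
      ((F.cast (U₀ ⊓ U₁) (show p - 1 + 1 = p by ring) (show q - 1 + 1 = q by ring)).comp
        ((F.dbar (p - 1 + 1) (q - 1) (U₀ ⊓ U₁)).comp
          ((F.del (p - 1) (q - 1) (U₀ ⊓ U₁)).comp pC))))

/-- the Čech differential `E^{(p,q)+1}(𝒰) → E^{p+1,q+1}_{A?}(𝒰)`; more precisely the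
differential `E^{(p,q)+1}(𝒰) → E^{p+1,q+1}(𝒰)`-component of the mixed complex, landing in
the Aeppli-type cochains `E^{p+1,q+1}_{A}(𝒰)`:
`((α₀,β₀), (α₁,β₁), γ) ↦ (∂̄α₀ + ∂β₀, ∂̄α₁ + ∂β₁, (α₁ - α₀ - ∂γ, β₁ - β₀ - ∂̄γ))` -/
def DtoTA (p q : ℤ) : TT F U₀ U₁ p q →ₗ[ℂ] TA F U₀ U₁ (p + 1) (q + 1) :=
  lmTri
    (((F.dbar (p + 1) q U₀).comp (qA.comp pA)) + ((F.del p (q + 1) U₀).comp (qB.comp pA)))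
    (((F.dbar (p + 1) q U₁).comp (qA.comp pB)) + ((F.del p (q + 1) U₁).comp (qB.comp pB)))
    (LinearMap.prod
      ((F.cast (U₀ ⊓ U₁) rfl (show q = q + 1 - 1 by ring)).comp
        (((F.res (p + 1) q inf_le_right).comp (qA.comp pB) -
            (F.res (p + 1) q inf_le_left).comp (qA.comp pA)) -
          ((F.del p q (U₀ ⊓ U₁)).comp pC)))
      ((F.cast (U₀ ⊓ U₁) (show p = p + 1 - 1 by ring) rfl).comp
        (((F.res p (q + 1) inf_le_right).comp (qB.comp pB) -
            (F.res p (q + 1) inf_le_left).comp (qB.comp pA)) -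
          ((F.dbar p q (U₀ ⊓ U₁)).comp pC))))

/-- the Čech differential `E^{p,q}_{A}(𝒰) → E^{p+1,q+1}_{BC}(𝒰)`:
`(ξ₀, ξ₁, (η₁, η₂)) ↦ (∂̄∂ξ₀, ∂̄∂ξ₁, ξ₁ - ξ₀ - ∂̄η₁ - ∂η₂)` -/
def DtoTBC (p q : ℤ) : TA F U₀ U₁ p q →ₗ[ℂ] TBC F U₀ U₁ (p + 1) (q + 1) :=
  lmTri
    ((F.dbar (p + 1) q U₀).comp ((F.del p q U₀).comp pA))
    ((F.dbar (p + 1) q U₁).comp ((F.del p q U₁).comp pB))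
    ((F.cast (U₀ ⊓ U₁) (show p = p + 1 - 1 by ring) (show q = q + 1 - 1 by ring)).comp
      ((((F.res p q inf_le_right).comp pB - (F.res p q inf_le_left).comp pA) -
          ((F.cast (U₀ ⊓ U₁) rfl (show q - 1 + 1 = q by ring)).comp
            ((F.dbar p (q - 1) (U₀ ⊓ U₁)).comp (qA.comp pC)))) -
        ((F.cast (U₀ ⊓ U₁) (show p - 1 + 1 = p by ring) rfl).comp
          ((F.del (p - 1) q (U₀ ⊓ U₁)).comp (qB.comp pC)))))

/-- the Čech–Dolbeault differential `∂̄ϑ σ = (∂̄σ₀, ∂̄σ₁, σ₁ - σ₀ - ∂̄σ₀₁)` -/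
def DD (p q : ℤ) : TD F U₀ U₁ p q →ₗ[ℂ] TD F U₀ U₁ p (q + 1) :=
  lmTri
    ((F.dbar p q U₀).comp pA)
    ((F.dbar p q U₁).comp pB)
    (((F.cast (U₀ ⊓ U₁) rfl (show q = q + 1 - 1 by ring)).comp
        ((F.res p q inf_le_right).comp pB - (F.res p q inf_le_left).comp pA)) -
      ((F.cast (U₀ ⊓ U₁) rfl (show q - 1 + 1 = q + 1 - 1 by ring)).comp
        ((F.dbar p (q - 1) (U₀ ⊓ U₁)).comp pC)))

/-- the relative Čech differential `E^{p,q}_{BC}(𝒰,U₀) → E^{(p,q)+1}(𝒰,U₀)` -/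
def RtoTT (p q : ℤ) : RBC F U₀ U₁ p q →ₗ[ℂ] RT F U₀ U₁ p q :=
  LinearMap.prod
    (LinearMap.prod ((F.del p q U₁).comp qA) ((F.dbar p q U₁).comp qA))
    (((F.res p q inf_le_right).comp qA) -
      ((F.cast (U₀ ⊓ U₁) (show p - 1 + 1 = p by ring) (show q - 1 + 1 = q by ring)).comp
        ((F.dbar (p - 1 + 1) (q - 1) (U₀ ⊓ U₁)).comp
          ((F.del (p - 1) (q - 1) (U₀ ⊓ U₁)).comp qB))))

/-- the relative Čech differential `E^{(p,q)+1}(𝒰,U₀) → E^{p+1,q+1}_{A}(𝒰,U₀)` -/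
def RtoTA (p q : ℤ) : RT F U₀ U₁ p q →ₗ[ℂ] RA F U₀ U₁ (p + 1) (q + 1) :=
  LinearMap.prod
    (((F.dbar (p + 1) q U₁).comp (qA.comp qA)) + ((F.del p (q + 1) U₁).comp (qB.comp qA)))
    (LinearMap.prod
      ((F.cast (U₀ ⊓ U₁) rfl (show q = q + 1 - 1 by ring)).comp
        (((F.res (p + 1) q inf_le_right).comp (qA.comp qA)) -
          ((F.del p q (U₀ ⊓ U₁)).comp qB)))
      ((F.cast (U₀ ⊓ U₁) (show p = p + 1 - 1 by ring) rfl).comp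
        (((F.res p (q + 1) inf_le_right).comp (qB.comp qA)) -
          ((F.dbar p q (U₀ ⊓ U₁)).comp qB))))

/-- the relative Čech differential `E^{p,q}_{A}(𝒰,U₀) → E^{p+1,q+1}_{BC}(𝒰,U₀)` -/
def RtoTBC (p q : ℤ) : RA F U₀ U₁ p q →ₗ[ℂ] RBC F U₀ U₁ (p + 1) (q + 1) :=
  LinearMap.prod
    ((F.dbar (p + 1) q U₁).comp ((F.del p q U₁).comp qA))
    ((F.cast (U₀ ⊓ U₁) (show p = p + 1 - 1 by ring) (show q = q + 1 - 1 by ring)).comp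
      ((((F.res p q inf_le_right).comp qA) -
          ((F.cast (U₀ ⊓ U₁) rfl (show q - 1 + 1 = q by ring)).comp
            ((F.dbar p (q - 1) (U₀ ⊓ U₁)).comp (qA.comp qB)))) -
        ((F.cast (U₀ ⊓ U₁) (show p - 1 + 1 = p by ring) rfl).comp
          ((F.del (p - 1) q (U₀ ⊓ U₁)).comp (qB.comp qB)))))

/-- the relative Čech–Dolbeault differential -/
def DrD (p q : ℤ) : RD F U₀ U₁ p q →ₗ[ℂ] RD F U₀ U₁ p (q + 1) :=
  LinearMap.prod
    ((F.dbar p q U₁).comp qA)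
    (((F.cast (U₀ ⊓ U₁) rfl (show q = q + 1 - 1 by ring)).comp
        ((F.res p q inf_le_right).comp qA)) -
      ((F.cast (U₀ ⊓ U₁) rfl (show q - 1 + 1 = q + 1 - 1 by ring)).comp
        ((F.dbar p (q - 1) (U₀ ⊓ U₁)).comp qB)))

/-- identification of Čech–Bott–Chern cochains in equal bidegrees -/
def castTBC {p q p' q' : ℤ} (hp : p = p') (hq : q = q') :
    TBC F U₀ U₁ p q →ₗ[ℂ] TBC F U₀ U₁ p' q' :=
  lmTri ((F.cast U₀ hp hq).comp pA) ((F.cast U₁ hp hq).comp pB)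
    ((F.cast _ (by rw [hp]) (by rw [hq])).comp pC)

/-- identification of Čech–Aeppli cochains in equal bidegrees -/
def castTA {p q p' q' : ℤ} (hp : p = p') (hq : q = q') :
    TA F U₀ U₁ p q →ₗ[ℂ] TA F U₀ U₁ p' q' :=
  lmTri ((F.cast U₀ hp hq).comp pA) ((F.cast U₁ hp hq).comp pB)
    (LinearMap.prod ((F.cast _ hp (by rw [hq])).comp (qA.comp pC))
      ((F.cast _ (by rw [hp]) hq).comp (qB.comp pC)))

/-- identification of Čech–Dolbeault cochains in equal bidegrees -/
def castTD {p q p' q' : ℤ} (hp : p = p') (hq : q = q') :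
    TD F U₀ U₁ p q →ₗ[ℂ] TD F U₀ U₁ p' q' :=
  lmTri ((F.cast U₀ hp hq).comp pA) ((F.cast U₁ hp hq).comp pB)
    ((F.cast _ hp (by rw [hq])).comp pC)

/-- identification of relative Čech–Bott–Chern cochains in equal bidegrees -/
def castRBC {p q p' q' : ℤ} (hp : p = p') (hq : q = q') :
    RBC F U₀ U₁ p q →ₗ[ℂ] RBC F U₀ U₁ p' q' :=
  LinearMap.prod ((F.cast U₁ hp hq).comp qA)
    ((F.cast _ (by rw [hp]) (by rw [hq])).comp qB)

/-- identification of relative Čech–Aeppli cochains in equal bidegrees -/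
def castRA {p q p' q' : ℤ} (hp : p = p') (hq : q = q') :
    RA F U₀ U₁ p q →ₗ[ℂ] RA F U₀ U₁ p' q' :=
  LinearMap.prod ((F.cast U₁ hp hq).comp qA)
    (LinearMap.prod ((F.cast _ hp (by rw [hq])).comp (qA.comp qB))
      ((F.cast _ (by rw [hp]) hq).comp (qB.comp qB)))

/-- identification of relative Čech–Dolbeault cochains in equal bidegrees -/
def castRD {p q p' q' : ℤ} (hp : p = p') (hq : q = q') :
    RD F U₀ U₁ p q →ₗ[ℂ] RD F U₀ U₁ p' q' :=
  LinearMap.prod ((F.cast U₁ hp hq).comp qA)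
    ((F.cast _ hp (by rw [hq])).comp qB)

/-- the Čech–Bott–Chern cohomology `H^{p,q}_{BC}(𝒰)` -/
abbrev HBCcech (p q : ℤ) : Type u :=
  cohomOf
    ((castTBC F U₀ U₁ (show p - 1 + 1 = p by ring) (show q - 1 + 1 = q by ring)).comp
      (DtoTBC F U₀ U₁ (p - 1) (q - 1)))
    (DtoTT F U₀ U₁ p q)

/-- the Čech–Aeppli cohomology `H^{p,q}_{A}(𝒰)` -/
abbrev HAcech (p q : ℤ) : Type u :=
  cohomOf
    ((castTA F U₀ U₁ (show p - 1 + 1 = p by ring) (show q - 1 + 1 = q by ring)).comp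
      (DtoTA F U₀ U₁ (p - 1) (q - 1)))
    (DtoTBC F U₀ U₁ p q)

/-- the Čech cohomology of the third type `H^{(p,q)+1}(𝒰)` -/
abbrev HTcech (p q : ℤ) : Type u :=
  cohomOf (DtoTT F U₀ U₁ p q) (DtoTA F U₀ U₁ p q)

/-- the Čech–Dolbeault cohomology `H^{p,q}_{∂̄ϑ}(𝒰)` -/
abbrev HDcech (p q : ℤ) : Type u :=
  cohomOf ((castTD F U₀ U₁ rfl (show q - 1 + 1 = q by ring)).comp (DD F U₀ U₁ p (q - 1)))
    (DD F U₀ U₁ p q)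

/-- the relative Bott–Chern cohomology `H^{p,q}_{BC}(𝒰, U₀)` -/
abbrev HBCrel (p q : ℤ) : Type u :=
  cohomOf
    ((castRBC F U₀ U₁ (show p - 1 + 1 = p by ring) (show q - 1 + 1 = q by ring)).comp
      (RtoTBC F U₀ U₁ (p - 1) (q - 1)))
    (RtoTT F U₀ U₁ p q)

/-- the relative Aeppli cohomology `H^{p,q}_{A}(𝒰, U₀)` -/
abbrev HArel (p q : ℤ) : Type u :=
  cohomOf
    ((castRA F U₀ U₁ (show p - 1 + 1 = p by ring) (show q - 1 + 1 = q by ring)).comp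
      (RtoTA F U₀ U₁ (p - 1) (q - 1)))
    (RtoTBC F U₀ U₁ p q)

/-- the relative cohomology of the third type `H^{(p,q)+1}(𝒰, U₀)` -/
abbrev HTrel (p q : ℤ) : Type u :=
  cohomOf (RtoTT F U₀ U₁ p q) (RtoTA F U₀ U₁ p q)

/-- the relative Dolbeault cohomology `H^{p,q}_{∂̄ϑ}(𝒰, U₀)` -/
abbrev HDrel (p q : ℤ) : Type u :=
  cohomOf ((castRD F U₀ U₁ rfl (show q - 1 + 1 = q by ring)).comp (DrD F U₀ U₁ p (q - 1)))
    (DrD F U₀ U₁ p q)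

end Cech

section OpenSet

variable (W : Opens X)

/-- the differential `∂̄ + ∂ : E^{(p-1,q-1)+1}(W) → E^{p,q}(W)`, `(η₁, η₂) ↦ ∂̄η₁ + ∂η₂` -/
def plusW (p q : ℤ) :
    (↥(F.E p (q - 1) W) × ↥(F.E (p - 1) q W)) →ₗ[ℂ] ↥(F.E p q W) :=
  ((F.cast W rfl (show q - 1 + 1 = q by ring)).comp ((F.dbar p (q - 1) W).comp qA)) +
    ((F.cast W (show p - 1 + 1 = p by ring) rfl).comp ((F.del (p - 1) q W).comp qB))

/-- the differential `∂̄∂ : E^{p,q}(W) → E^{p+1,q+1}(W)` -/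
def ddbarW (p q : ℤ) : ↥(F.E p q W) →ₗ[ℂ] ↥(F.E (p + 1) (q + 1) W) :=
  (F.dbar (p + 1) q W).comp (F.del p q W)

/-- the differential `d : E^{p,q}(W) → E^{(p,q)+1}(W)`, `ω ↦ (∂ω, ∂̄ω)` -/
def dfullW (p q : ℤ) :
    ↥(F.E p q W) →ₗ[ℂ] (↥(F.E (p + 1) q W) × ↥(F.E p (q + 1) W)) :=
  LinearMap.prod (F.del p q W) (F.dbar p q W)

/-- the differential `∂̄ + ∂ : E^{(p,q)+1}(W) → E^{p+1,q+1}(W)`, `(α, β) ↦ ∂̄α + ∂β` -/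
def plusTW (p q : ℤ) :
    (↥(F.E (p + 1) q W) × ↥(F.E p (q + 1) W)) →ₗ[ℂ] ↥(F.E (p + 1) (q + 1) W) :=
  ((F.dbar (p + 1) q W).comp qA) + ((F.del p (q + 1) W).comp qB)

/-- the Bott–Chern cohomology `H^{p,q}_{BC}(W)` of an open set `W` -/
abbrev HBCopen (p q : ℤ) : Type u :=
  cohomOf
    ((F.cast W (show p - 1 + 1 = p by ring) (show q - 1 + 1 = q by ring)).comp
      (ddbarW F W (p - 1) (q - 1)))
    (dfullW F W p q)

/-- the Aeppli cohomology `H^{p,q}_{A}(W)` of an open set `W` -/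
abbrev HAopen (p q : ℤ) : Type u :=
  cohomOf (plusW F W p q) (ddbarW F W p q)

/-- the cohomology of the third type `H^{(p,q)+1}(W)` of an open set `W` -/
abbrev HTopen (p q : ℤ) : Type u :=
  cohomOf (dfullW F W p q) (plusTW F W p q)

/-- the Dolbeault cohomology `H^{p,q}_{∂̄}(W)` of an open set `W` -/
abbrev HDopen (p q : ℤ) : Type u :=
  cohomOf ((F.cast W rfl (show q - 1 + 1 = q by ring)).comp (F.dbar p (q - 1) W))
    (F.dbar p q W)

end OpenSet

section Tilde

variable (U₀ U₁ : Opens X)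

/-- the map `ω ↦ (ω|_{U₀}, ω|_{U₁}, 0)` into Čech–Bott–Chern cochains -/
def tBC (p q : ℤ) : ↥(F.E p q ⊤) →ₗ[ℂ] TBC F U₀ U₁ p q :=
  lmTri (F.res p q le_top) (F.res p q le_top) 0

/-- the map `ω ↦ (ω|_{U₀}, ω|_{U₁}, 0, 0)` into Čech–Aeppli cochains -/
def tA (p q : ℤ) : ↥(F.E p q ⊤) →ₗ[ℂ] TA F U₀ U₁ p q :=
  lmTri (F.res p q le_top) (F.res p q le_top) 0

/-- the map `ω ↦ (ω|_{U₀}, ω|_{U₁}, 0)` into Čech–Dolbeault cochains -/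
def tD (p q : ℤ) : ↥(F.E p q ⊤) →ₗ[ℂ] TD F U₀ U₁ p q :=
  lmTri (F.res p q le_top) (F.res p q le_top) 0

end Tilde

end DoubleFormSheaf

namespace DoubleFormSheaf

variable {X : Type u} [TopologicalSpace X] (F : DoubleFormSheaf X)

theorem cast_self {U : Opens X} {p q : ℤ} (hp : p = p) (hq : q = q) (x : F.E p q U) :
    F.cast U hp hq x = x := rfl

theorem cast_cast {U : Opens X} {p q p' q' p'' q'' : ℤ} (hp : p = p') (hq : q = q')
    (hp' : p' = p'') (hq' : q' = q'') (x : F.E p q U) :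
    F.cast U hp' hq' (F.cast U hp hq x) = F.cast U (hp.trans hp') (hq.trans hq') x := by
  subst hp hq hp' hq'
  rfl

theorem dbar_cast {U : Opens X} {p q p' q' : ℤ} (hp : p = p') (hq : q = q') (x : F.E p q U) :
    F.dbar p' q' U (F.cast U hp hq x) =
      F.cast U hp (congrArg (· + 1) hq) (F.dbar p q U x) := by
  subst hp hq
  rfl

theorem del_cast {U : Opens X} {p q p' q' : ℤ} (hp : p = p') (hq : q = q') (x : F.E p q U) :
    F.del p' q' U (F.cast U hp hq x) =
      F.cast U (congrArg (· + 1) hp) hq (F.del p q U x) := by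
  subst hp hq
  rfl

theorem res_cast {U V : Opens X} (h : U ≤ V) {p q p' q' : ℤ} (hp : p = p') (hq : q = q')
    (x : F.E p q V) :
    F.res p' q' h (F.cast V hp hq x) = F.cast U hp hq (F.res p q h x) := by
  subst hp hq
  rfl

/-- On a two-set open cover every form on the overlap is a difference of forms on the members. -/
theorem exists_res_sub_res {U V : Opens X} (h : U ⊔ V = ⊤) {p q : ℤ} (x : F.E p q (U ⊓ V)) :
    ∃ (y : F.E p q U) (z : F.E p q V),
      F.res p q inf_le_right z - F.res p q inf_le_left y = x := by
  obtain ⟨z₀, z₁, hz⟩ := F.pou h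
  refine ⟨-z₀ p q x, z₁ p q x, ?_⟩
  rw [map_neg, sub_neg_eq_add, add_comm, hz]

/-- The explicit form of the Čech differential into Aeppli cochains, in the bidegree `(p, q)`. -/
theorem castTA_DtoTA_apply (U₀ U₁ : Opens X) (p q : ℤ) (t : TT F U₀ U₁ (p - 1) (q - 1)) :
    castTA F U₀ U₁ (sub_add_cancel p 1) (sub_add_cancel q 1) (DtoTA F U₀ U₁ (p - 1) (q - 1) t) =
      (F.cast U₀ (sub_add_cancel p 1) (sub_add_cancel q 1)
          (F.dbar _ _ U₀ t.1.1 + F.del _ _ U₀ t.1.2),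
        F.cast U₁ (sub_add_cancel p 1) (sub_add_cancel q 1)
          (F.dbar _ _ U₁ t.2.1.1 + F.del _ _ U₁ t.2.1.2),
        F.cast _ (sub_add_cancel p 1) rfl
          (F.res _ _ inf_le_right t.2.1.1 - F.res _ _ inf_le_left t.1.1 - F.del _ _ _ t.2.2),
        F.cast _ rfl (sub_add_cancel q 1)
          (F.res _ _ inf_le_right t.2.1.2 - F.res _ _ inf_le_left t.1.2 -
            F.dbar _ _ _ t.2.2)) := by
  refine Prod.ext rfl (Prod.ext rfl (Prod.ext ?_ ?_))
  · exact F.cast_cast ..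
  · exact F.cast_cast ..

end DoubleFormSheaf

open DoubleFormSheaf

/-- Lemma 3.10 of the paper: `B^{p,q}_A(𝒰) = B'`. -/
theorem statement6 {X : Type u} [TopologicalSpace X] (F : DoubleFormSheaf X)
    (U₀ U₁ : Opens X) (hcov : U₀ ⊔ U₁ = ⊤) (p q : ℤ) :
    Set.range
        ((castTA F U₀ U₁ (show p - 1 + 1 = p by ring) (show q - 1 + 1 = q by ring)).comp
          (DtoTA F U₀ U₁ (p - 1) (q - 1)))
      = {ξ : TA F U₀ U₁ p q |
          ∃ (a₀ : ↥(F.E p (q - 1) U₀)) (b₀ : ↥(F.E (p - 1) q U₀))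
            (a₁ : ↥(F.E p (q - 1) U₁)) (b₁ : ↥(F.E (p - 1) q U₁))
            (c₁₁ : ↥(F.E p (q - 2) (U₀ ⊓ U₁))) (c₁₂ : ↥(F.E (p - 1) (q - 1) (U₀ ⊓ U₁)))
            (c₂₂ : ↥(F.E (p - 2) q (U₀ ⊓ U₁))),
            ξ.1 = F.cast U₀ rfl (show q - 1 + 1 = q by ring) (F.dbar p (q - 1) U₀ a₀)
                + F.cast U₀ (show p - 1 + 1 = p by ring) rfl (F.del (p - 1) q U₀ b₀) ∧
            ξ.2.1 = F.cast U₁ rfl (show q - 1 + 1 = q by ring) (F.dbar p (q - 1) U₁ a₁)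
                + F.cast U₁ (show p - 1 + 1 = p by ring) rfl (F.del (p - 1) q U₁ b₁) ∧
            ξ.2.2.1 = F.res p (q - 1) inf_le_right a₁ - F.res p (q - 1) inf_le_left a₀
                - F.cast _ rfl (show q - 2 + 1 = q - 1 by ring)
                    (F.dbar p (q - 2) (U₀ ⊓ U₁) c₁₁)
                - F.cast _ (show p - 1 + 1 = p by ring) rfl
                    (F.del (p - 1) (q - 1) (U₀ ⊓ U₁) c₁₂) ∧
            ξ.2.2.2 = F.res (p - 1) q inf_le_right b₁ - F.res (p - 1) q inf_le_left b₀
                - F.cast _ rfl (show q - 1 + 1 = q by ring)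
                    (F.dbar (p - 1) (q - 1) (U₀ ⊓ U₁) c₁₂)
                - F.cast _ (show p - 2 + 1 = p - 1 by ring) rfl
                    (F.del (p - 2) q (U₀ ⊓ U₁) c₂₂)} := by
  ext ξ
  constructor
  · rintro ⟨⟨⟨α₀, β₀⟩, ⟨α₁, β₁⟩, γ⟩, rfl⟩
    rw [LinearMap.comp_apply, castTA_DtoTA_apply]
    refine ⟨F.cast _ (sub_add_cancel p 1) rfl α₀, F.cast _ rfl (sub_add_cancel q 1) β₀,
      F.cast _ (sub_add_cancel p 1) rfl α₁, F.cast _ rfl (sub_add_cancel q 1) β₁,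
      0, γ, 0, ?_, ?_, ?_, ?_⟩ <;>
    simp only [map_add, map_sub, map_zero, sub_zero, dbar_cast, del_cast, res_cast, F.cast_cast]
  · obtain ⟨ξ₀, ξ₁, ξ₂, ξ₃⟩ := ξ
    rintro ⟨a₀, b₀, a₁, b₁, c₁₁, c₁₂, c₂₂, h₀, h₁, h₂, h₃⟩
    dsimp only at h₀ h₁ h₂ h₃
    subst h₀ h₁ h₂ h₃
    obtain ⟨y, z, rfl⟩ := F.exists_res_sub_res hcov c₁₁
    obtain ⟨v, w, rfl⟩ := F.exists_res_sub_res hcov c₂₂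
    have hp : p = p - 1 + 1 := (sub_add_cancel p 1).symm
    have hq : q = q - 1 + 1 := (sub_add_cancel q 1).symm
    have hp' : p - 2 + 1 = p - 1 := by ring
    have hq' : q - 2 + 1 = q - 1 := by ring
    refine ⟨((F.cast _ hp rfl (a₀ - F.cast _ rfl hq' (F.dbar _ _ _ y)),
        F.cast _ rfl hq (b₀ - F.cast _ hp' rfl (F.del _ _ _ v))),
      (F.cast _ hp rfl (a₁ - F.cast _ rfl hq' (F.dbar _ _ _ z)),
        F.cast _ rfl hq (b₁ - F.cast _ hp' rfl (F.del _ _ _ w))), c₁₂), ?_⟩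
    rw [LinearMap.comp_apply, castTA_DtoTA_apply]
    refine Prod.ext ?_ (Prod.ext ?_ (Prod.ext ?_ ?_)) <;>
    simp only [map_add, map_sub, map_zero, sub_zero, dbar_cast, del_cast, res_cast, F.cast_cast,
      dbar_dbar, del_del, res_dbar, res_del, F.cast_self]
    all_goals abel
end
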